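/- (Γ-liminf inequality.) Let ε_k → 0 be a sequence of positive numbers and let μ_k, μ be Borel probability measures on ℝ^d such that μ_k → μ weakly-* (i.e., ∫ f dμ_k → ∫ f dμ for every bounded continuous f : ℝ^d → ℝ). Then liminf_{k→∞} E_{ε_k}(μ_k) ≥ E(μ). -/

import Mathlib

open MeasureTheory Filter
open scoped ENNReal Topology NNReal

noncomputable section

/-- Power-law interaction kernel `K(x) = |x|^q/q - |x|^p/p` (real-valued). -/
noncomputable def Kfun (d : ℕ) (p q : ℝ) (x : EuclideanSpace ℝ (Fin d)) : ℝ :=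
  ‖x‖ ^ q / q - ‖x‖ ^ p / p

/-- Power-law interaction kernel, valued in `[0,∞]` (note `K 0 = ∞` when `p < 0 < q`). -/
noncomputable def KE (d : ℕ) (p q : ℝ) (x : EuclideanSpace ℝ (Fin d)) : ℝ≥0∞ :=
  (‖x‖₊ : ℝ≥0∞) ^ q / ENNReal.ofReal q + (‖x‖₊ : ℝ≥0∞) ^ p / ENNReal.ofReal (-p)

/-- Repulsive part `K^r(x) = -|x|^p/p` of the power-law kernel, valued in `[0,∞]`. -/
noncomputable def KrE (d : ℕ) (p : ℝ) (x : EuclideanSpace ℝ (Fin d)) : ℝ≥0∞ :=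
  (‖x‖₊ : ℝ≥0∞) ^ p / ENNReal.ofReal (-p)

/-- Rescaled mollifier `φ_ε(x) = ε^{-d} φ(x/ε)`. -/
noncomputable def scaled (d : ℕ) (φ : EuclideanSpace ℝ (Fin d) → ℝ) (ε : ℝ)
    (x : EuclideanSpace ℝ (Fin d)) : ℝ :=
  (ε ^ d)⁻¹ * φ (ε⁻¹ • x)

/-- Mollifier hypotheses (M1)–(M3). -/
def IsMollifier (d : ℕ) (φ : EuclideanSpace ℝ (Fin d) → ℝ) : Prop :=
  ContDiff ℝ (⊤ : ℕ∞) φ ∧ (∀ x y, ‖x‖ = ‖y‖ → φ x = φ y) ∧ (∀ x, 0 ≤ φ x) ∧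
    (∫ x, φ x) = 1 ∧
    ∃ C : ℝ, 0 < C ∧ ∃ l : ℝ, max (2 * (d : ℝ) + 1) 4 ≤ l ∧
      ∀ x : EuclideanSpace ℝ (Fin d), x ≠ 0 → φ x ≤ C * ‖x‖ ^ (-l)

/-- Regularized kernel `K_ε = φ_ε * K * φ_ε` (real-valued). -/
noncomputable def Kreg (d : ℕ) (p q : ℝ) (φ : EuclideanSpace ℝ (Fin d) → ℝ) (ε : ℝ)
    (x : EuclideanSpace ℝ (Fin d)) : ℝ :=
  ∫ y, ∫ z, scaled d φ ε y * Kfun d p q (x - y - z) * scaled d φ ε z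

/-- Double mollification `g * K * g` of a `[0,∞]`-valued kernel by a nonnegative function. -/
noncomputable def convE (d : ℕ) (g : EuclideanSpace ℝ (Fin d) → ℝ)
    (K : EuclideanSpace ℝ (Fin d) → ℝ≥0∞) (x : EuclideanSpace ℝ (Fin d)) : ℝ≥0∞ :=
  ∫⁻ y, ∫⁻ z, ENNReal.ofReal (g y) * K (x - y - z) * ENNReal.ofReal (g z)

/-- Interaction energy `E(μ) = ∬ K(x-y) dμ(x) dμ(y)` for a `[0,∞]`-valued kernel. -/
noncomputable def energyE (d : ℕ) (K : EuclideanSpace ℝ (Fin d) → ℝ≥0∞)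
    (μ : Measure (EuclideanSpace ℝ (Fin d))) : ℝ≥0∞ :=
  ∫⁻ x, ∫⁻ y, K (x - y) ∂μ ∂μ

/-- Regularized interaction energy `E_ε(μ) = ∬ K_ε(x-y) dμ(x) dμ(y)`. -/
noncomputable def energyReg (d : ℕ) (p q : ℝ) (φ : EuclideanSpace ℝ (Fin d) → ℝ) (ε : ℝ)
    (μ : Measure (EuclideanSpace ℝ (Fin d))) : ℝ≥0∞ :=
  energyE d (fun x => ENNReal.ofReal (Kreg d p q φ ε x)) μ

/-- Real-valued interaction energy. -/
noncomputable def energyReal (d : ℕ) (p q : ℝ) (μ : Measure (EuclideanSpace ℝ (Fin d))) : ℝ :=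
  ∫ x, ∫ y, Kfun d p q (x - y) ∂μ ∂μ

/-- Borel probability measure with finite second moment. -/
def IsP2 (d : ℕ) (μ : Measure (EuclideanSpace ℝ (Fin d))) : Prop :=
  IsProbabilityMeasure μ ∧ (∫⁻ x, (‖x‖₊ : ℝ≥0∞) ^ 2 ∂μ) < ⊤

/-- The heat kernel `ψ_ε(x) = (4πε)^{-d/2} e^{-|x|²/(4ε)}`. -/
noncomputable def heat (d : ℕ) (ε : ℝ) (x : EuclideanSpace ℝ (Fin d)) : ℝ :=
  (4 * Real.pi * ε) ^ (-(d : ℝ) / 2) * Real.exp (-‖x‖ ^ 2 / (4 * ε))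

/-- Weak-* convergence of a sequence of measures: convergence of integrals of all bounded
continuous functions. -/
def WeakStarTendsto (d : ℕ) (μ : ℕ → Measure (EuclideanSpace ℝ (Fin d)))
    (ν : Measure (EuclideanSpace ℝ (Fin d))) : Prop :=
  ∀ f : EuclideanSpace ℝ (Fin d) → ℝ, Continuous f → (∃ M : ℝ, ∀ x, |f x| ≤ M) →
    Tendsto (fun k => ∫ x, f x ∂(μ k)) atTop (𝓝 (∫ x, f x ∂ν))

/-- `μ` is absolutely continuous (w.r.t. Lebesgue) with density bounded by `R`. -/
def HasBddDensity (d : ℕ) (μ : Measure (EuclideanSpace ℝ (Fin d))) (R : ℝ) : Prop :=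
  ∃ ρ : EuclideanSpace ℝ (Fin d) → ℝ≥0∞, Measurable ρ ∧ μ = volume.withDensity ρ ∧
    ∀ᵐ x ∂(volume : Measure (EuclideanSpace ℝ (Fin d))), ρ x ≤ ENNReal.ofReal R

/-- Explicit gradient `∇K(x) = x|x|^{q-2} - x|x|^{p-2}` of the power-law kernel. -/
noncomputable def gradK (d : ℕ) (p q : ℝ) (x : EuclideanSpace ℝ (Fin d)) :
    EuclideanSpace ℝ (Fin d) :=
  (‖x‖ ^ (q - 2)) • x - (‖x‖ ^ (p - 2)) • x

/-- The log-Lipschitz modulus of convexity `ω`. -/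
noncomputable def omegaMod (x : ℝ) : ℝ :=
  if x ≤ Real.exp (-1 - Real.sqrt 2) then x * |Real.log x|
  else Real.sqrt (x ^ 2 + 2 * (1 + Real.sqrt 2) * Real.exp (-1 - Real.sqrt 2) * x)

/-- Support of a measure: points all of whose neighborhoods have positive measure. -/
def msupport (d : ℕ) (μ : Measure (EuclideanSpace ℝ (Fin d))) :
    Set (EuclideanSpace ℝ (Fin d)) :=
  {x | ∀ r : ℝ, 0 < r → 0 < μ (Metric.ball x r)}

/-- The measure `μ * ψ_δ` obtained by mollifying `μ` with the heat kernel at scale `δ`. -/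
noncomputable def heatMollified (d : ℕ) (μ : Measure (EuclideanSpace ℝ (Fin d))) (δ : ℝ) :
    Measure (EuclideanSpace ℝ (Fin d)) :=
  volume.withDensity fun x => ENNReal.ofReal (∫ y, heat d δ (x - y) ∂μ)
theorem aux_KE_continuous (d : ℕ) (p q : ℝ) (hp2 : p < 0) (hq1 : 0 < q) :
    Continuous (KE d p q) := by
  have h1 : Continuous fun x : EuclideanSpace ℝ (Fin d) => (‖x‖₊ : ℝ≥0∞) :=
    ENNReal.continuous_coe.comp continuous_nnnorm
  unfold KE
  refine Continuous.add ?_ ?_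
  · exact (ENNReal.continuous_div_const _ (by simpa using hq1)).comp
      (ENNReal.continuous_rpow_const.comp h1)
  · exact (ENNReal.continuous_div_const _ (by simpa using hp2)).comp
      (ENNReal.continuous_rpow_const.comp h1)

theorem aux_lsc {X : Type*} [TopologicalSpace X] [MeasurableSpace X] [OpensMeasurableSpace X]
    (K : X → ℝ≥0∞) (hK : Continuous K) (lam : ℕ → ProbabilityMeasure X)
    (lam0 : ProbabilityMeasure X) (h : Tendsto lam atTop (𝓝 lam0)) :
    ∫⁻ x, K x ∂(lam0 : Measure X) ≤ atTop.liminf (fun k => ∫⁻ x, K x ∂(lam k : Measure X)) := by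
  have hsup : ∀ x, K x = ⨆ n : ℕ, min (K x) (n : ℝ≥0∞) := by
    intro x
    rw [← inf_iSup_eq, ENNReal.iSup_natCast, inf_top_eq]
  have hmono : Monotone fun (n : ℕ) (x : X) => min (K x) (n : ℝ≥0∞) := by
    intro m n hmn x
    exact min_le_min le_rfl (by exact_mod_cast hmn)
  have h0 : ∫⁻ x, K x ∂(lam0 : Measure X)
      = ⨆ n : ℕ, ∫⁻ x, min (K x) (n : ℝ≥0∞) ∂(lam0 : Measure X) := by
    rw [← lintegral_iSup (fun n => (hK.min continuous_const).measurable) hmono]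
    exact lintegral_congr hsup
  rw [h0]
  refine iSup_le fun n => ?_
  have hne : ∀ x, min (K x) (n : ℝ≥0∞) ≠ ⊤ := fun x =>
    ((min_le_right _ _).trans_lt (ENNReal.natCast_lt_top n)).ne
  let f : BoundedContinuousFunction X ℝ≥0 :=
    BoundedContinuousFunction.mkOfBound
      ⟨fun x => (min (K x) (n : ℝ≥0∞)).toNNReal, by
        exact ENNReal.continuousOn_toNNReal.comp_continuous (hK.min continuous_const) hne⟩
      n (by
        intro x y
        have hb : ∀ x, (min (K x) (n : ℝ≥0∞)).toNNReal ≤ (n : ℝ≥0) := by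
          intro x
          have := ENNReal.toNNReal_mono (ENNReal.natCast_ne_top n) (min_le_right (K x) (n : ℝ≥0∞))
          simpa using this
        have hx := hb x
        have hy := hb y
        rw [NNReal.dist_eq]
        have hx' : (((min (K x) (n : ℝ≥0∞)).toNNReal : ℝ≥0) : ℝ) ≤ n := by exact_mod_cast hx
        have hy' : (((min (K y) (n : ℝ≥0∞)).toNNReal : ℝ≥0) : ℝ) ≤ n := by exact_mod_cast hy
        have hx0 := ((min (K x) (n : ℝ≥0∞)).toNNReal).coe_nonneg
        have hy0 := ((min (K y) (n : ℝ≥0∞)).toNNReal).coe_nonneg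
        simp only [ContinuousMap.coe_mk]
        rw [abs_le]
        constructor <;> linarith)
  have hf : ∀ x, ((f x : ℝ≥0) : ℝ≥0∞) = min (K x) (n : ℝ≥0∞) := fun x =>
    ENNReal.coe_toNNReal (hne x)
  have ht := ProbabilityMeasure.tendsto_iff_forall_lintegral_tendsto.1 h f
  simp only [hf] at ht
  rw [← ht.liminf_eq]
  exact liminf_le_liminf (Eventually.of_forall fun k => lintegral_mono fun x => min_le_left _ _)

theorem aux_Kfun_KE (d : ℕ) (p q : ℝ) (hp2 : p < 0) (hq1 : 0 < q)
    (x : EuclideanSpace ℝ (Fin d)) (hx : x ≠ 0) :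
    ENNReal.ofReal (Kfun d p q x) = KE d p q x := by
  have hn : 0 < ‖x‖ := norm_pos_iff.2 hx
  have he : (‖x‖₊ : ℝ≥0∞) = ENNReal.ofReal ‖x‖ := by
    rw [ofReal_norm]; rfl
  unfold Kfun KE
  rw [he, ENNReal.ofReal_rpow_of_pos hn, ENNReal.ofReal_rpow_of_pos hn,
    ← ENNReal.ofReal_div_of_pos hq1, ← ENNReal.ofReal_div_of_pos (by linarith : 0 < -p),
    ← ENNReal.ofReal_add (by positivity) (div_nonneg (by positivity) (by linarith))]
  congr 1
  rw [div_neg]; ring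

theorem aux_Kfun_nonneg (d : ℕ) (p q : ℝ) (hp2 : p < 0) (hq1 : 0 < q)
    (x : EuclideanSpace ℝ (Fin d)) : 0 ≤ Kfun d p q x := by
  unfold Kfun
  have h1 : 0 ≤ ‖x‖ ^ q / q := by positivity
  have h2 : ‖x‖ ^ p / p ≤ 0 := div_nonpos_of_nonneg_of_nonpos (by positivity) hp2.le
  linarith

theorem aux_Kfun_measurable (d : ℕ) (p q : ℝ) : Measurable (Kfun d p q) := by
  unfold Kfun
  fun_prop

/-- Real double convolution versus the `[0,∞]`-valued one. -/
theorem aux_conv_eq (d : ℕ) (hd : 3 ≤ d) (p q : ℝ) (hp2 : p < 0) (hq1 : 0 < q)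
    (g : EuclideanSpace ℝ (Fin d) → ℝ) (hg : Continuous g) (hg0 : ∀ x, 0 ≤ g x)
    (x : EuclideanSpace ℝ (Fin d)) (hfin : convE d g (KE d p q) x ≠ ⊤) :
    ENNReal.ofReal (∫ y, ∫ z, g y * Kfun d p q (x - y - z) * g z) = convE d g (KE d p q) x := by
  have hKm := aux_Kfun_measurable d p q
  have hKEm := (aux_KE_continuous d p q hp2 hq1).measurable
  have hgm := hg.measurable
  have : Nonempty (Fin d) := ⟨⟨0, by omega⟩⟩
  have hjm : Measurable (Function.uncurry fun y z : EuclideanSpace ℝ (Fin d) =>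
      g y * Kfun d p q (x - y - z) * g z) := by
    unfold Function.uncurry
    fun_prop
  have hjE : Measurable (Function.uncurry fun y z : EuclideanSpace ℝ (Fin d) =>
      ENNReal.ofReal (g y) * KE d p q (x - y - z) * ENNReal.ofReal (g z)) := by
    unfold Function.uncurry
    fun_prop
  have hnn : ∀ y z, 0 ≤ g y * Kfun d p q (x - y - z) * g z := fun y z =>
    mul_nonneg (mul_nonneg (hg0 y) (aux_Kfun_nonneg d p q hp2 hq1 _)) (hg0 z)
  have hin : ∀ y, ∫⁻ z, ENNReal.ofReal (g y * Kfun d p q (x - y - z) * g z)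
      = ∫⁻ z, ENNReal.ofReal (g y) * KE d p q (x - y - z) * ENNReal.ofReal (g z) := by
    intro y
    refine lintegral_congr_ae ?_
    have : ∀ᵐ z ∂(volume : Measure (EuclideanSpace ℝ (Fin d))), z ≠ x - y :=
      Measure.ae_ne volume (x - y)
    filter_upwards [this] with z hz
    rw [ENNReal.ofReal_mul (mul_nonneg (hg0 y) (aux_Kfun_nonneg d p q hp2 hq1 _)),
      ENNReal.ofReal_mul (hg0 y), aux_Kfun_KE d p q hp2 hq1]
    exact sub_ne_zero.2 hz.symm
  have hF : ∀ y, ∫ z, g y * Kfun d p q (x - y - z) * g z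
      = (∫⁻ z, ENNReal.ofReal (g y) * KE d p q (x - y - z) * ENNReal.ofReal (g z)).toReal := by
    intro y
    rw [← hin y, integral_eq_lintegral_of_nonneg_ae (Eventually.of_forall (hnn y))]
    exact (hjm.comp measurable_prodMk_left).aestronglyMeasurable
  have hmI : Measurable fun y => ∫⁻ z, ENNReal.ofReal (g y) * KE d p q (x - y - z)
      * ENNReal.ofReal (g z) := hjE.lintegral_prod_right'
  have hfin' := hfin
  unfold convE at hfin'
  have hae := ae_lt_top hmI hfin'
  simp_rw [hF]
  rw [integral_toReal hmI.aemeasurable hae, ENNReal.ofReal_toReal hfin']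
  rfl

/-- Finiteness of the double convolution. -/
theorem aux_conv_fin (d : ℕ) (hd : 3 ≤ d) (p q : ℝ) (hp1 : 2 - (d : ℝ) ≤ p) (hp2 : p < 0)
    (hq1 : 0 < q) (hq2 : q ≤ 2)
    (g : EuclideanSpace ℝ (Fin d) → ℝ) (hg : Continuous g) (hg0 : ∀ x, 0 ≤ g x)
    (hgi : Integrable g) (G : ℝ) (hG : ∀ x, g x ≤ G)
    (hg2 : Integrable fun x => ‖x‖ ^ 2 * g x)
    (x : EuclideanSpace ℝ (Fin d)) : convE d g (KE d p q) x ≠ ⊤ := by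
  have hKm := aux_Kfun_measurable d p q
  have hgm := hg.measurable
  have : Nonempty (Fin d) := ⟨⟨0, by omega⟩⟩
  have hG0 : 0 ≤ G := (hg0 0).trans (hG 0)
  -- the local singular part
  let S : EuclideanSpace ℝ (Fin d) → ℝ :=
    (Metric.ball (0 : EuclideanSpace ℝ (Fin d)) 1).indicator fun w => ‖w‖ ^ p
  have hS0 : ∀ w, 0 ≤ S w := fun w => Set.indicator_nonneg (fun w _ => by positivity) w
  have hSi : Integrable S := by
    have h1 : IntegrableOn (fun w : EuclideanSpace ℝ (Fin d) => ‖w‖ ^ p)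
        (Metric.ball 0 1) volume := by
      refine integrableOn_ball_of_norm_le_rpow (C := 1) (α := -p) ?_ ?_ ?_ ?_
      · simp; omega
      · simp; linarith
      · refine Eventually.of_forall fun w => ?_
        rw [neg_neg, one_mul, Real.norm_of_nonneg (by positivity)]
      · exact (by fun_prop : Measurable fun w : EuclideanSpace ℝ (Fin d) => ‖w‖ ^ p).aestronglyMeasurable
    exact (integrable_indicator_iff measurableSet_ball).2 h1
  -- pointwise bound of the kernel
  have hKb : ∀ y z : EuclideanSpace ℝ (Fin d), Kfun d p q (x - y - z) ≤
      (1 + 3 * (‖x‖ ^ 2 + ‖y‖ ^ 2 + ‖z‖ ^ 2)) / q + (S (x - y - z) + 1) / (-p) := by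
    intro y z
    have ha : ‖x - y - z‖ ^ q ≤ 1 + 3 * (‖x‖ ^ 2 + ‖y‖ ^ 2 + ‖z‖ ^ 2) := by
      have h1 : ‖x - y - z‖ ^ q ≤ 1 + ‖x - y - z‖ ^ 2 := by
        rcases le_total ‖x - y - z‖ 1 with h | h
        · have := Real.rpow_le_one (norm_nonneg (x - y - z)) h hq1.le
          nlinarith [sq_nonneg ‖x - y - z‖]
        · have := Real.rpow_le_rpow_of_exponent_le h hq2
          rw [Real.rpow_two] at this
          linarith
      have h2 : ‖x - y - z‖ ≤ ‖x‖ + ‖y‖ + ‖z‖ :=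
        (norm_sub_le _ _).trans (by linarith [norm_sub_le x y])
      have h3 : ‖x - y - z‖ ^ 2 ≤ (‖x‖ + ‖y‖ + ‖z‖) ^ 2 :=
        pow_le_pow_left₀ (norm_nonneg _) h2 2
      nlinarith [sq_nonneg (‖x‖ - ‖y‖), sq_nonneg (‖x‖ - ‖z‖), sq_nonneg (‖y‖ - ‖z‖)]
    have hb : ‖x - y - z‖ ^ p ≤ S (x - y - z) + 1 := by
      by_cases h : x - y - z ∈ Metric.ball (0 : EuclideanSpace ℝ (Fin d)) 1
      · simp only [S, Set.indicator_of_mem h]; linarith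
      · have h' : 1 ≤ ‖x - y - z‖ := by simpa using h
        have := Real.rpow_le_one_of_one_le_of_nonpos h' hp2.le
        linarith [hS0 (x - y - z)]
    unfold Kfun
    have e : ‖x - y - z‖ ^ q / q - ‖x - y - z‖ ^ p / p
        = ‖x - y - z‖ ^ q / q + ‖x - y - z‖ ^ p / (-p) := by rw [div_neg]; ring
    rw [e]
    have : 0 < -p := by linarith
    gcongr
  set A : ℝ := (1 + 3 * ‖x‖ ^ 2) / q + 1 / (-p) with hA
  have hA0 : 0 ≤ A := by
    have : 0 < -p := by linarith
    positivity
  have hinn : ∀ y, ∫⁻ z, ENNReal.ofReal (g y) * KE d p q (x - y - z) * ENNReal.ofReal (g z)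
      ≤ ENNReal.ofReal ((A * ∫ z, g z) * g y + (3 / q * ∫ z, g z) * (‖y‖ ^ 2 * g y)
        + (3 / q * ∫ z, ‖z‖ ^ 2 * g z) * g y + (G / (-p) * ∫ z, S z) * g y) := by
    intro y
    have hSt : Integrable fun z => S (x - y - z) := hSi.comp_sub_left (x - y)
    have hbi : Integrable fun z => (A * g y + 3 / q * (‖y‖ ^ 2 * g y)) * g z
        + (3 / q * g y) * (‖z‖ ^ 2 * g z) + (G / (-p) * g y) * S (x - y - z) :=
      ((hgi.const_mul _).add (hg2.const_mul _)).add (hSt.const_mul _)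
    have hp' : 0 < -p := by linarith
    have e1 : ∫ z, ((A * g y + 3 / q * (‖y‖ ^ 2 * g y)) * g z
        + (3 / q * g y) * (‖z‖ ^ 2 * g z) + (G / (-p) * g y) * S (x - y - z))
        = ((A * ∫ z, g z) * g y + (3 / q * ∫ z, g z) * (‖y‖ ^ 2 * g y)
        + (3 / q * ∫ z, ‖z‖ ^ 2 * g z) * g y + (G / (-p) * ∫ z, S z) * g y) := by
      have hab : Integrable fun z => (A * g y + 3 / q * (‖y‖ ^ 2 * g y)) * g z
          + (3 / q * g y) * (‖z‖ ^ 2 * g z) := (hgi.const_mul _).add (hg2.const_mul _)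
      rw [integral_add hab (hSt.const_mul _),
        integral_add (hgi.const_mul _) (hg2.const_mul _), integral_const_mul, integral_const_mul,
        integral_const_mul, integral_sub_left_eq_self S volume (x - y)]
      ring
    rw [← e1, ofReal_integral_eq_lintegral_ofReal hbi]
    · refine lintegral_mono_ae ?_
      have : ∀ᵐ z ∂(volume : Measure (EuclideanSpace ℝ (Fin d))), z ≠ x - y :=
        Measure.ae_ne volume (x - y)
      filter_upwards [this] with z hz
      rw [← aux_Kfun_KE d p q hp2 hq1 _ (sub_ne_zero.2 hz.symm), ← ENNReal.ofReal_mul (hg0 y),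
        ← ENNReal.ofReal_mul (mul_nonneg (hg0 y) (aux_Kfun_nonneg d p q hp2 hq1 _))]
      refine ENNReal.ofReal_le_ofReal ?_
      have h1 := mul_le_mul_of_nonneg_left (hKb y z) (mul_nonneg (hg0 y) (hg0 z))
      have h2 : g y * (S (x - y - z) / (-p)) * g z ≤ g y * (S (x - y - z) / (-p)) * G :=
        mul_le_mul_of_nonneg_left (hG z)
          (mul_nonneg (hg0 y) (div_nonneg (hS0 _) hp'.le))
      calc g y * Kfun d p q (x - y - z) * g z = g y * g z * Kfun d p q (x - y - z) := by ring
        _ ≤ _ := h1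
        _ = (A * g y + 3 / q * (‖y‖ ^ 2 * g y)) * g z
            + (3 / q * g y) * (‖z‖ ^ 2 * g z) + g y * (S (x - y - z) / (-p)) * g z := by
          rw [hA]; ring
        _ ≤ (A * g y + 3 / q * (‖y‖ ^ 2 * g y)) * g z
            + (3 / q * g y) * (‖z‖ ^ 2 * g z) + g y * (S (x - y - z) / (-p)) * G := by
          linarith
        _ = _ := by ring
    · refine Eventually.of_forall fun z => ?_
      have := hg0 y
      have := hg0 z
      have := hS0 (x - y - z)
      simp only [Pi.zero_apply]
      positivity
  have hout : Integrable fun y => (A * ∫ z, g z) * g y + (3 / q * ∫ z, g z) * (‖y‖ ^ 2 * g y)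
        + (3 / q * ∫ z, ‖z‖ ^ 2 * g z) * g y + (G / (-p) * ∫ z, S z) * g y :=
    (((hgi.const_mul _).add (hg2.const_mul _)).add (hgi.const_mul _)).add (hgi.const_mul _)
  unfold convE
  exact ((lintegral_mono hinn).trans_lt hout.lintegral_lt_top).ne

/-- Consequences of the mollifier hypotheses. -/
theorem aux_moll (d : ℕ) (hd : 3 ≤ d) (φ : EuclideanSpace ℝ (Fin d) → ℝ) (hφ : IsMollifier d φ) :
    Continuous φ ∧ (∀ x, 0 ≤ φ x) ∧ Integrable φ ∧ (∃ G, ∀ x, φ x ≤ G) ∧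
      Integrable (fun x => ‖x‖ ^ 2 * φ x) ∧ (∫ x, φ x) = 1 := by
  obtain ⟨hc, -, h0, h1, C, hC, l, hl, hb⟩ := hφ
  have hcont := hc.continuous
  have hl1 : 2 * (d : ℝ) + 1 ≤ l := (le_max_left _ _).trans hl
  have hd' : (3 : ℝ) ≤ d := by exact_mod_cast hd
  obtain ⟨M, hM⟩ := (isCompact_closedBall (0 : EuclideanSpace ℝ (Fin d)) 1).bddAbove_image
    hcont.continuousOn
  have hM' : ∀ x : EuclideanSpace ℝ (Fin d), ‖x‖ ≤ 1 → φ x ≤ M := fun x hx =>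
    hM ⟨x, by simpa using hx, rfl⟩
  have hM0 : 0 ≤ M := (h0 0).trans (hM' 0 (by simp))
  have key : ∀ x, φ x ≤ ((M + C) * 2 ^ l) * (1 + ‖x‖) ^ (-l) := by
    intro x
    have hpos : (0:ℝ) < 1 + ‖x‖ := by positivity
    rcases le_total ‖x‖ 1 with h | h
    · have e : (1 : ℝ) ≤ 2 ^ l * (1 + ‖x‖) ^ (-l) := by
        rw [Real.rpow_neg hpos.le, ← div_eq_mul_inv, one_le_div (by positivity)]
        exact Real.rpow_le_rpow hpos.le (by linarith) (by linarith)
      calc φ x ≤ M := hM' x h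
        _ ≤ (M + C) * 1 := by linarith
        _ ≤ (M + C) * (2 ^ l * (1 + ‖x‖) ^ (-l)) := by gcongr
        _ = _ := by ring
    · have hx0 : 0 < ‖x‖ := by linarith
      have e : ‖x‖ ^ (-l) ≤ 2 ^ l * (1 + ‖x‖) ^ (-l) := by
        rw [Real.rpow_neg hpos.le, Real.rpow_neg hx0.le, ← div_eq_mul_inv,
          ← Real.div_rpow (by norm_num) hpos.le, ← Real.inv_rpow hx0.le]
        refine Real.rpow_le_rpow (by positivity) ?_ (by linarith)
        rw [inv_eq_one_div, div_le_div_iff₀ hx0 hpos]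
        linarith
      calc φ x ≤ C * ‖x‖ ^ (-l) := hb x (norm_pos_iff.1 hx0)
        _ ≤ (M + C) * (2 ^ l * (1 + ‖x‖) ^ (-l)) := by gcongr; linarith
        _ = _ := by ring
  refine ⟨hcont, h0, ?_, ⟨(M + C) * 2 ^ l, fun x => ?_⟩, ?_, h1⟩
  · by_contra h
    rw [integral_undef h] at h1
    exact zero_ne_one h1
  · refine (key x).trans ?_
    have : (1 + ‖x‖) ^ (-l) ≤ 1 :=
      Real.rpow_le_one_of_one_le_of_nonpos (by linarith [norm_nonneg x]) (by linarith)
    exact mul_le_of_le_one_right (by positivity) this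
  · have hi : Integrable fun x : EuclideanSpace ℝ (Fin d) => (1 + ‖x‖) ^ (-(l - 2)) :=
      integrable_one_add_norm (by simp; linarith)
    refine (hi.const_mul ((M + C) * 2 ^ l)).mono'
      (by fun_prop : Continuous fun x => ‖x‖ ^ 2 * φ x).aestronglyMeasurable
      (Eventually.of_forall fun x => ?_)
    have hpos : (0:ℝ) < 1 + ‖x‖ := by positivity
    rw [Real.norm_of_nonneg (mul_nonneg (by positivity) (h0 x))]
    have e : (1 + ‖x‖) ^ (-(l - 2)) = (1 + ‖x‖) ^ 2 * (1 + ‖x‖) ^ (-l) := by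
      rw [← Real.rpow_two, ← Real.rpow_add hpos]; congr 1; ring
    rw [e]
    calc ‖x‖ ^ 2 * φ x ≤ (1 + ‖x‖) ^ 2 * (((M + C) * 2 ^ l) * (1 + ‖x‖) ^ (-l)) :=
          mul_le_mul (by gcongr; linarith) (key x) (h0 x) (by positivity)
      _ = _ := by ring

theorem aux_scaled (d : ℕ) (φ : EuclideanSpace ℝ (Fin d) → ℝ) (hc : Continuous φ)
    (ε : ℝ) (hε : 0 < ε) :
    volume.withDensity (fun x => ENNReal.ofReal (scaled d φ ε x))
      = (volume.withDensity (fun x => ENNReal.ofReal (φ x))).map (fun x => ε • x) := by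
  have hm := hc.measurable
  have hs : Measurable (fun x : EuclideanSpace ℝ (Fin d) => ε • x) := by fun_prop
  ext s hsm
  rw [Measure.map_apply hs hsm, withDensity_apply _ hsm, withDensity_apply _ (hs hsm),
    ← lintegral_indicator hsm, ← lintegral_indicator (hs hsm)]
  let h : EuclideanSpace ℝ (Fin d) → ℝ≥0∞ := s.indicator fun x => ENNReal.ofReal (φ (ε⁻¹ • x))
  have hhm : Measurable h := by
    refine Measurable.indicator ?_ hsm
    fun_prop
  have e := lintegral_map (μ := volume) hhm hs
  rw [Measure.map_addHaar_smul volume hε.ne', lintegral_smul_measure] at e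
  have e2 : ∀ x, h (ε • x) = ((fun x => ε • x) ⁻¹' s).indicator (fun x => ENNReal.ofReal (φ x)) x := by
    intro x
    simp only [h, Set.indicator, Set.mem_preimage, inv_smul_smul₀ hε.ne']
    rfl
  simp_rw [e2] at e
  rw [← e, smul_eq_mul, ← lintegral_const_mul _ hhm]
  refine lintegral_congr fun x => ?_
  by_cases hx : x ∈ s
  · simp only [h, Set.indicator_of_mem hx, scaled]
    rw [ENNReal.ofReal_mul (by positivity), abs_of_pos (by simp; positivity)]
    simp
  · simp [h, hx]

theorem aux_convE_eq (d : ℕ) (g : EuclideanSpace ℝ (Fin d) → ℝ) (hg : Continuous g)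
    (K : EuclideanSpace ℝ (Fin d) → ℝ≥0∞) (hK : Measurable K) (x : EuclideanSpace ℝ (Fin d)) :
    convE d g K x = ∫⁻ y, ∫⁻ z, K (x - y - z)
      ∂(volume.withDensity (fun x => ENNReal.ofReal (g x)))
      ∂(volume.withDensity (fun x => ENNReal.ofReal (g x))) := by
  have hm := hg.measurable
  have hme : Measurable fun x => ENNReal.ofReal (g x) := by fun_prop
  have hi : ∀ y, ∫⁻ z, K (x - y - z) ∂(volume.withDensity (fun x => ENNReal.ofReal (g x)))
      = ∫⁻ z, ENNReal.ofReal (g z) * K (x - y - z) := fun y =>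
    lintegral_withDensity_eq_lintegral_mul _ hme (by fun_prop)
  simp_rw [hi]
  rw [lintegral_withDensity_eq_lintegral_mul _ hme]
  · unfold convE
    refine lintegral_congr fun y => ?_
    simp only [Pi.mul_apply]
    rw [← lintegral_const_mul _ (by fun_prop)]
    refine lintegral_congr fun z => ?_
    ring
  · have : Measurable (Function.uncurry fun y z : EuclideanSpace ℝ (Fin d) =>
      ENNReal.ofReal (g z) * K (x - y - z)) := by
      unfold Function.uncurry
      fun_prop
    exact this.lintegral_prod_right'

theorem aux_energy (d : ℕ) (K : EuclideanSpace ℝ (Fin d) → ℝ≥0∞) (hK : Measurable K)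
    (m P : Measure (EuclideanSpace ℝ (Fin d))) [IsProbabilityMeasure m] [IsProbabilityMeasure P] :
    ∫⁻ x, ∫⁻ y, ∫⁻ u, ∫⁻ v, K (x - y - u - v) ∂P ∂P ∂m ∂m
      = ∫⁻ w, K w ∂(m.conv ((m.map (fun x => (-1 : ℝ) • x)).conv
        ((P.map (fun x => (-1 : ℝ) • x)).conv (P.map (fun x => (-1 : ℝ) • x))))) := by
  have hs : Measurable (fun x : EuclideanSpace ℝ (Fin d) => (-1 : ℝ) • x) := by fun_prop
  have : IsProbabilityMeasure (m.map (fun x => (-1 : ℝ) • x)) :=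
    Measure.isProbabilityMeasure_map hs.aemeasurable
  have : IsProbabilityMeasure (P.map (fun x => (-1 : ℝ) • x)) :=
    Measure.isProbabilityMeasure_map hs.aemeasurable
  rw [Measure.lintegral_conv hK]
  refine lintegral_congr fun x => ?_
  rw [Measure.lintegral_conv (by fun_prop), lintegral_map _ hs]
  · refine lintegral_congr fun y => ?_
    rw [Measure.lintegral_conv (by fun_prop), lintegral_map _ hs]
    · refine lintegral_congr fun u => ?_
      rw [lintegral_map (by fun_prop) hs]
      refine lintegral_congr fun v => ?_
      congr 1
      simp only [neg_smul, one_smul]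
      abel
    · refine Measurable.lintegral_prod_right' (f := fun z : EuclideanSpace ℝ (Fin d) ×
        EuclideanSpace ℝ (Fin d) => K (x + ((-1 : ℝ) • y + (z.1 + z.2)))) ?_
      fun_prop
  · refine Measurable.lintegral_prod_right' (f := fun z : EuclideanSpace ℝ (Fin d) ×
        EuclideanSpace ℝ (Fin d) => K (x + (z.1 + z.2))) ?_
    fun_prop

theorem aux_energy0 (d : ℕ) (K : EuclideanSpace ℝ (Fin d) → ℝ≥0∞) (hK : Measurable K)
    (m : Measure (EuclideanSpace ℝ (Fin d))) [IsProbabilityMeasure m] :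
    energyE d K m = ∫⁻ w, K w ∂(m.conv (m.map (fun x => (-1 : ℝ) • x))) := by
  have hs : Measurable (fun x : EuclideanSpace ℝ (Fin d) => (-1 : ℝ) • x) := by fun_prop
  have : IsProbabilityMeasure (m.map (fun x => (-1 : ℝ) • x)) :=
    Measure.isProbabilityMeasure_map hs.aemeasurable
  rw [Measure.lintegral_conv hK]
  refine lintegral_congr fun x => ?_
  rw [lintegral_map (by fun_prop) hs]
  refine lintegral_congr fun y => ?_
  congr 1
  simp only [neg_smul, one_smul]
  abel

/-- Γ-liminf inequality: if `ε_k → 0`, `ε_k > 0`, and `μ_k → μ` weakly-*,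
then `liminf_k E_{ε_k}(μ_k) ≥ E(μ)`. -/
theorem gamma_liminf_regularized_energies
    (d : ℕ) (hd : 3 ≤ d) (p q : ℝ) (hp1 : 2 - (d : ℝ) ≤ p) (hp2 : p < 0)
    (hq1 : 0 < q) (hq2 : q ≤ 2)
    (φ : EuclideanSpace ℝ (Fin d) → ℝ) (hφ : IsMollifier d φ)
    (ε : ℕ → ℝ) (hεpos : ∀ k, 0 < ε k) (hε0 : Tendsto ε atTop (𝓝 0))
    (μ : ℕ → Measure (EuclideanSpace ℝ (Fin d))) (hμ : ∀ k, IsProbabilityMeasure (μ k))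
    (ν : Measure (EuclideanSpace ℝ (Fin d))) (hν : IsProbabilityMeasure ν)
    (hconv : WeakStarTendsto d μ ν) :
    energyE d (KE d p q) ν ≤ atTop.liminf (fun k => energyReg d p q φ (ε k) (μ k)) := by
  obtain ⟨hc, h0, hi, ⟨G, hG⟩, h2, h1⟩ := aux_moll d hd φ hφ
  have hKc := aux_KE_continuous d p q hp2 hq1
  have hs : ∀ c : ℝ, Measurable (fun x : EuclideanSpace ℝ (Fin d) => c • x) := fun c => by fun_prop
  set P1 : Measure (EuclideanSpace ℝ (Fin d)) :=
    volume.withDensity (fun x => ENNReal.ofReal (φ x)) with hP1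
  have : IsProbabilityMeasure P1 := by
    constructor
    rw [hP1, withDensity_apply _ MeasurableSet.univ, Measure.restrict_univ,
      ← ofReal_integral_eq_lintegral_ofReal hi (Eventually.of_forall h0), h1, ENNReal.ofReal_one]
  let P : ℕ → Measure (EuclideanSpace ℝ (Fin d)) := fun k => P1.map (fun x => ε k • x)
  have hPp : ∀ k, IsProbabilityMeasure (P k) := fun k =>
    Measure.isProbabilityMeasure_map (hs _).aemeasurable
  have hneg : ∀ m : Measure (EuclideanSpace ℝ (Fin d)), [IsProbabilityMeasure m] →
      IsProbabilityMeasure (m.map (fun x => (-1 : ℝ) • x)) := fun m _ =>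
    Measure.isProbabilityMeasure_map (hs _).aemeasurable
  -- energies as integrals against laws
  have hE : ∀ k, energyReg d p q φ (ε k) (μ k) = ∫⁻ w, KE d p q w
      ∂((μ k).conv (((μ k).map (fun x => (-1 : ℝ) • x)).conv
        (((P k).map (fun x => (-1 : ℝ) • x)).conv ((P k).map (fun x => (-1 : ℝ) • x))))) := by
    intro k
    have hε := hεpos k
    rw [← aux_energy d _ hKc.measurable]
    unfold energyReg energyE
    refine lintegral_congr fun x => lintegral_congr fun y => ?_
    have hcs : Continuous (scaled d φ (ε k)) := by unfold scaled; fun_prop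
    have h0s : ∀ x, 0 ≤ scaled d φ (ε k) x := fun x =>
      mul_nonneg (by positivity) (h0 _)
    have his : Integrable (scaled d φ (ε k)) :=
      (hi.comp_smul (inv_ne_zero hε.ne')).const_mul _
    have h2s : Integrable fun x => ‖x‖ ^ 2 * scaled d φ (ε k) x := by
      refine ((h2.comp_smul (inv_ne_zero hε.ne')).const_mul
        ((ε k ^ d)⁻¹ * (ε k) ^ 2)).congr (Eventually.of_forall fun x => ?_)
      simp only [scaled, norm_smul, norm_inv, Real.norm_of_nonneg hε.le]
      field_simp
    have hfin := aux_conv_fin d hd p q hp1 hp2 hq1 hq2 (scaled d φ (ε k)) hcs h0s his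
      ((ε k ^ d)⁻¹ * G) (fun x => mul_le_mul_of_nonneg_left (hG _) (by positivity)) h2s (x - y)
    unfold Kreg
    beta_reduce
    rw [aux_conv_eq d hd p q hp2 hq1 _ hcs h0s _ hfin,
      aux_convE_eq d _ hcs _ hKc.measurable, aux_scaled d φ hc _ hε]
  simp_rw [hE]
  rw [aux_energy0 d _ hKc.measurable]
  let lam : ℕ → ProbabilityMeasure (EuclideanSpace ℝ (Fin d)) := fun k =>
    ⟨(μ k).conv (((μ k).map (fun x => (-1 : ℝ) • x)).conv
        (((P k).map (fun x => (-1 : ℝ) • x)).conv ((P k).map (fun x => (-1 : ℝ) • x)))),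
      inferInstance⟩
  let lam0 : ProbabilityMeasure (EuclideanSpace ℝ (Fin d)) :=
    ⟨ν.conv (ν.map (fun x => (-1 : ℝ) • x)), inferInstance⟩
  refine aux_lsc (KE d p q) hKc lam lam0 ?_
  refine ProbabilityMeasure.tendsto_of_tendsto_charFun fun t => ?_
  have hμc : ∀ t, Tendsto (fun k => charFun (μ k) t) atTop (𝓝 (charFun ν t)) := by
    let M : ℕ → ProbabilityMeasure (EuclideanSpace ℝ (Fin d)) := fun k => ⟨μ k, hμ k⟩
    let N : ProbabilityMeasure (EuclideanSpace ℝ (Fin d)) := ⟨ν, hν⟩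
    have : Tendsto M atTop (𝓝 N) := by
      rw [ProbabilityMeasure.tendsto_iff_forall_integral_tendsto]
      intro f
      exact hconv f f.continuous ⟨‖f‖, fun x => f.norm_coe_le_norm x⟩
    exact fun t => ProbabilityMeasure.tendsto_iff_tendsto_charFun.1 this t
  have hPc : Tendsto (fun k => charFun P1 (ε k • (-1 : ℝ) • t)) atTop (𝓝 1) := by
    have hcc : Continuous (charFun P1) := continuous_charFun
    have h3 : Tendsto (fun k => ε k • (-1 : ℝ) • t) atTop (𝓝 0) := by
      simpa using hε0.smul_const ((-1 : ℝ) • t)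
    have h4 := (hcc.tendsto 0).comp h3
    have h5 : charFun P1 0 = 1 := by simp [charFun_zero]
    rw [h5] at h4
    exact h4
  have := (hμc t).mul ((hμc ((-1 : ℝ) • t)).mul (hPc.mul hPc))
  simp only [mul_one] at this
  simp only [lam, lam0, ProbabilityMeasure.coe_mk, charFun_conv, charFun_map_smul, P]
  exact this
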